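/- Let w : ℝ × 𝕋² → ℝ be a smooth, strictly positive, bounded function whose logarithmic gradient ∂ log w is bounded. Then for every compactly supported C² one-form φ = φₐ dxᵃ on ℝ × 𝕋² (a = 1,2,3), one has ∫ w |∂φ|² dx ≤ 4 ∫ w |curl φ|² dx + 4 ∫ w |div φ|² dx + 3 ‖∂ log w‖²_{L^∞} ∫ w |φ|² dx, where all integrals are with respect to the product Lebesgue measure dx = dx¹dx²dx³. -/

import Mathlib

open MeasureTheory

namespace EllAux

/-- Partial derivative. -/
noncomputable def P (i : Fin 3) (g : (Fin 3 → ℝ) → ℝ) (x : Fin 3 → ℝ) : ℝ :=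
  fderiv ℝ g x (Pi.single i 1)

lemma P_contDiff {g : (Fin 3 → ℝ) → ℝ} {m n : WithTop ℕ∞} (hg : ContDiff ℝ n g) (h : m + 1 ≤ n)
    (i : Fin 3) : ContDiff ℝ m (P i g) :=
  (hg.fderiv_right h).clm_apply contDiff_const

lemma P_mul {f g : (Fin 3 → ℝ) → ℝ} (hf : ContDiff ℝ 1 f) (hg : ContDiff ℝ 1 g) (i : Fin 3)
    (x : Fin 3 → ℝ) : P i (fun y => f y * g y) x = f x * P i g x + P i f x * g x := by
  unfold P
  rw [fderiv_fun_mul (hf.differentiable (by simp) x) (hg.differentiable (by simp) x)]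
  simp [mul_comm]

lemma P_sub {f g : (Fin 3 → ℝ) → ℝ} (hf : ContDiff ℝ 1 f) (hg : ContDiff ℝ 1 g) (i : Fin 3)
    (x : Fin 3 → ℝ) : P i (fun y => f y - g y) x = P i f x - P i g x := by
  unfold P
  rw [fderiv_fun_sub (hf.differentiable (by simp) x) (hg.differentiable (by simp) x)]
  simp

lemma P_sum {f : Fin 3 → (Fin 3 → ℝ) → ℝ} (hf : ∀ j, ContDiff ℝ 1 (f j)) (i : Fin 3)
    (x : Fin 3 → ℝ) : P i (fun y => ∑ j, f j y) x = ∑ j, P i (f j) x := by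
  unfold P
  rw [fderiv_fun_sum (fun j _ => (hf j).differentiable (by simp) x)]
  simp

lemma P_symm {f : (Fin 3 → ℝ) → ℝ} (hf : ContDiff ℝ 2 f) (i j : Fin 3)
    (x : Fin 3 → ℝ) : P i (P j f) x = P j (P i f) x := by
  have hd : DifferentiableAt ℝ (fderiv ℝ f) x :=
    (hf.fderiv_right (m := 1) (by norm_num)).differentiable (by simp) x
  have key : ∀ i j : Fin 3, P i (P j f) x =
      fderiv ℝ (fderiv ℝ f) x (Pi.single i 1) (Pi.single j 1) := by
    intro i j
    change fderiv ℝ (fun y => fderiv ℝ f y (Pi.single j 1)) x (Pi.single i 1) = _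
    rw [fderiv_clm_apply hd (differentiableAt_const _)]
    simp
  rw [key, key]
  exact (hf.contDiffAt.isSymmSndFDerivAt (by simp)).eq _ _

lemma P_per {f : (Fin 3 → ℝ) → ℝ} {v : Fin 3 → ℝ} (hf : ∀ x, f (x + v) = f x) (i : Fin 3)
    (x : Fin 3 → ℝ) : P i f (x + v) = P i f x := by
  unfold P
  rw [← fderiv_comp_add_right]
  simp only [hf]

lemma P_supp {f : (Fin 3 → ℝ) → ℝ} {R : ℝ} (hf : ∀ x, R ≤ |x 0| → f x = 0) (i : Fin 3)
    (x : Fin 3 → ℝ) (hx : R < |x 0|) : P i f x = 0 := by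
  unfold P
  have : f =ᶠ[nhds x] fun _ => 0 := by
    have ho : IsOpen {y : Fin 3 → ℝ | R < |y 0|} :=
      isOpen_lt continuous_const (by fun_prop)
    filter_upwards [ho.mem_nhds hx] with y hy
    exact hf y (le_of_lt hy)
  rw [this.fderiv_eq]
  simp

lemma P_log {w : (Fin 3 → ℝ) → ℝ} (hw : ContDiff ℝ 1 w) (hpos : ∀ x, 0 < w x) (i : Fin 3)
    (x : Fin 3 → ℝ) : P i w x = w x * P i (fun y => Real.log (w y)) x := by
  unfold P
  rw [fderiv.log (hw.differentiable (by simp) x) (hpos x).ne']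
  have := (hpos x).ne'
  simp
  field_simp

/-- lower corner -/
def lo (R : ℝ) : Fin 3 → ℝ := ![-R, 0, 0]
/-- upper corner -/
def hi (R : ℝ) : Fin 3 → ℝ := ![R, 1, 1]

lemma int_box {R : ℝ} (f : (Fin 3 → ℝ) → ℝ) (hf : ∀ x, R ≤ |x 0| → f x = 0) :
    ∫ x in {x : Fin 3 → ℝ | x 1 ∈ Set.Ico (0 : ℝ) 1 ∧ x 2 ∈ Set.Ico (0 : ℝ) 1}, f x
      = ∫ x in Set.Icc (lo R) (hi R), f x := by
  have h1 : ∫ x in Set.Icc (lo R) (hi R), f x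
      = ∫ x in (Set.univ.pi fun i => Set.Ico (lo R i) (hi R i)), f x :=
    (setIntegral_congr_set Measure.univ_pi_Ico_ae_eq_Icc).symm
  rw [h1]
  apply setIntegral_eq_of_subset_of_forall_sdiff_eq_zero
  · apply MeasurableSet.inter
    · exact (measurable_pi_apply 1) measurableSet_Ico
    · exact (measurable_pi_apply 2) measurableSet_Ico
  · intro x hx
    have a1 := hx 1 trivial
    have a2 := hx 2 trivial
    exact ⟨by simpa [lo, hi] using a1, by simpa [lo, hi] using a2⟩
  · intro x hx
    apply hf
    by_contra hlt
    push Not at hlt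
    apply hx.2
    intro i _
    have := abs_lt.1 hlt
    have b1 := hx.1.1
    have b2 := hx.1.2
    fin_cases i
    · exact ⟨by simpa [lo] using this.1.le, by simpa [hi] using this.2⟩
    · simpa [lo, hi] using b1
    · simpa [lo, hi] using b2

lemma int_div {R : ℝ} (hR : 0 ≤ R) (F : Fin 3 → (Fin 3 → ℝ) → ℝ) (hF : ∀ i, ContDiff ℝ 1 (F i))
    (hper : ∀ i, ∀ A : Fin 3, A ≠ 0 → ∀ x, F i (x + Pi.single A 1) = F i x)
    (hs : ∀ i x, R ≤ |x 0| → F i x = 0) :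
    ∫ x in Set.Icc (lo R) (hi R), ∑ i, P i (F i) x = 0 := by
  have hle : lo R ≤ hi R := by
    intro i
    fin_cases i <;> simp [lo, hi]
    linarith
  have hc : Continuous fun x => ∑ i, P i (F i) x :=
    continuous_finsetSum _ fun i _ => (P_contDiff (m := 0) (hF i) (by simp) i).continuous
  have := integral_divergence_of_hasFDerivAt_off_countable' (n := 2) (lo R) (hi R) hle F
    (fun i x => fderiv ℝ (F i) x) ∅ Set.countable_empty (fun i => (hF i).continuous.continuousOn)
    (fun x _ i => ((hF i).differentiable (by simp) x).hasFDerivAt)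
    (hc.continuousOn.integrableOn_compact isCompact_Icc)
  refine this.trans ?_
  apply Finset.sum_eq_zero
  intro i _
  rw [sub_eq_zero]
  congr 1
  funext y
  by_cases h0 : i = 0
  · subst h0
    rw [hs 0 _ (by simp [hi, le_abs_self]), hs 0 _ (by simp [lo, le_abs_self])]
  · rw [← hper i i h0 (i.insertNth (lo R i) y)]
    congr 1
    funext k
    refine Fin.succAboveCases i ?_ (fun j => ?_) k
    · have : hi R i = lo R i + 1 := by
        fin_cases i
        · exact absurd rfl h0
        · simp [lo, hi]
        · simp [lo, hi]
      simp [this]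
    · simp

lemma alg (w K : ℝ) (hw : 0 < w) (l f : Fin 3 → ℝ) (p : Fin 3 → Fin 3 → ℝ)
    (hl : ∑ i, l i ^ 2 ≤ K ^ 2) :
    w * ∑ i, ∑ j, (p i j) ^ 2 ≤
      4 * (w * ((p 1 2 - p 2 1) ^ 2 + (p 2 0 - p 0 2) ^ 2 + (p 0 1 - p 1 0) ^ 2))
      + 4 * (w * (∑ i, p i i) ^ 2) + 3 * K ^ 2 * (w * ∑ i, f i ^ 2)
      + 2 * (∑ i, w * l i * (∑ j, f j * p j i - f i * ∑ j, p j j)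
        + w * (∑ i, ∑ j, p i j * p j i - (∑ j, p j j) ^ 2)) := by
  have hS : (∑ i, l i ^ 2) * (∑ i, f i ^ 2) ≤ K ^ 2 * ∑ i, f i ^ 2 :=
    mul_le_mul_of_nonneg_right hl (Finset.sum_nonneg fun i _ => sq_nonneg _)
  have hCS : (∑ i, l i * f i) ^ 2 ≤ (∑ i, l i ^ 2) * (∑ i, f i ^ 2) :=
    Finset.sum_mul_sq_le_sq_mul_sq _ _ _
  have hN : 0 ≤ K ^ 2 * ∑ i, f i ^ 2 :=
    mul_nonneg (sq_nonneg _) (Finset.sum_nonneg fun i _ => sq_nonneg _)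
  have hQ : 0 ≤ ∑ i, ∑ j, (p j i + l i * f j) ^ 2 :=
    Finset.sum_nonneg fun i _ => Finset.sum_nonneg fun j _ => sq_nonneg _
  have hD : 0 ≤ (2 * (∑ i, p i i) - ∑ i, l i * f i) ^ 2 := sq_nonneg _
  have hC : 0 ≤ (p 1 2 - p 2 1) ^ 2 + (p 2 0 - p 0 2) ^ 2 + (p 0 1 - p 1 0) ^ 2 := by positivity
  have main : ∑ i, ∑ j, (p i j) ^ 2 ≤
      4 * ((p 1 2 - p 2 1) ^ 2 + (p 2 0 - p 0 2) ^ 2 + (p 0 1 - p 1 0) ^ 2)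
      + 4 * (∑ i, p i i) ^ 2 + 3 * (K ^ 2 * ∑ i, f i ^ 2)
      + 2 * (∑ i, l i * (∑ j, f j * p j i - f i * ∑ j, p j j)
        + (∑ i, ∑ j, p i j * p j i - (∑ j, p j j) ^ 2)) := by
    generalize hX : K ^ 2 * ∑ i, f i ^ 2 = X at *
    simp only [Fin.sum_univ_three] at *
    linarith
  have := mul_le_mul_of_nonneg_left main hw.le
  refine this.trans (le_of_eq ?_)
  simp only [mul_assoc, ← Finset.mul_sum]
  ring

lemma divF (w : (Fin 3 → ℝ) → ℝ) (hw : ContDiff ℝ 1 w) (φ : Fin 3 → (Fin 3 → ℝ) → ℝ)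
    (hφ : ∀ i, ContDiff ℝ 2 (φ i)) (x : Fin 3 → ℝ) :
    ∑ i, P i (fun y => w y * (∑ j, φ j y * P j (φ i) y - φ i y * ∑ j, P j (φ j) y)) x
      = ∑ i, P i w x * (∑ j, φ j x * P j (φ i) x - φ i x * ∑ j, P j (φ j) x)
        + w x * (∑ i, ∑ j, P i (φ j) x * P j (φ i) x - (∑ j, P j (φ j) x) ^ 2) := by
  have h1 : ∀ i, ContDiff ℝ 1 (φ i) := fun i => (hφ i).of_le (by norm_num)
  have hp : ∀ i j, ContDiff ℝ 1 (P i (φ j)) := fun i j => P_contDiff (hφ j) (by norm_num) i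
  have hdv : ContDiff ℝ 1 fun y => ∑ j, P j (φ j) y := ContDiff.sum fun j _ => hp j j
  have hm : ∀ i j, ContDiff ℝ 1 fun y => φ j y * P j (φ i) y := fun i j => (h1 j).mul (hp j i)
  have hs : ∀ i, ContDiff ℝ 1 fun y => ∑ j, φ j y * P j (φ i) y := fun i =>
    ContDiff.sum fun j _ => hm i j
  have hm2 : ∀ i, ContDiff ℝ 1 fun y => φ i y * ∑ j, P j (φ j) y := fun i => (h1 i).mul hdv
  have step : ∀ i, P i (fun y => w y * (∑ j, φ j y * P j (φ i) y - φ i y * ∑ j, P j (φ j) y)) x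
      = w x * ((∑ j, (φ j x * P i (P j (φ i)) x + P i (φ j) x * P j (φ i) x))
          - (φ i x * ∑ j, P i (P j (φ j)) x + P i (φ i) x * ∑ j, P j (φ j) x))
        + P i w x * (∑ j, φ j x * P j (φ i) x - φ i x * ∑ j, P j (φ j) x) := by
    intro i
    rw [P_mul hw ((hs i).sub (hm2 i)), P_sub (hs i) (hm2 i), P_sum (hm i), P_mul (h1 i) hdv,
      P_sum (fun j => hp j j)]
    simp only [P_mul (h1 _) (hp _ _)]
  simp only [step]
  simp only [Fin.sum_univ_three]
  rw [P_symm (hφ 0) 1 0, P_symm (hφ 0) 2 0, P_symm (hφ 1) 0 1, P_symm (hφ 1) 2 1,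
    P_symm (hφ 2) 0 2, P_symm (hφ 2) 1 2]
  ring

end EllAux

/-- Weighted Euclidean elliptic estimate on `ℝ × 𝕋²`, modeled as functions on
`ℝ³ = (Fin 3 → ℝ)` that are `1`-periodic in the coordinates `x¹ = x 1` and `x² = x 2`
(the torus directions) and compactly supported in the `x 0` direction, with integrals taken
over a fundamental domain `D = {x | x 1 ∈ [0,1), x 2 ∈ [0,1)}`. Here `pd i f x` is the `i`-th
Cartesian partial derivative `∂ᵢ f (x)`. The weight `w` is smooth, strictly positive, bounded,
with `|∂ log w| ≤ K` pointwise; `φ` is a compactly supported C² one-form. -/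
theorem stmt_2
    (pd : Fin 3 → ((Fin 3 → ℝ) → ℝ) → (Fin 3 → ℝ) → ℝ)
    (hpd : ∀ i g x, pd i g x = fderiv ℝ g x (Pi.single i 1))
    (w : (Fin 3 → ℝ) → ℝ) (hw : ContDiff ℝ (⊤ : ℕ∞) w)
    (hwpos : ∀ x, 0 < w x) (hwbdd : ∃ M : ℝ, ∀ x, w x ≤ M)
    (hwper : ∀ A : Fin 3, A ≠ 0 → ∀ x, w (x + Pi.single A 1) = w x)
    (K : ℝ) (hK : 0 ≤ K)
    (hlogw : ∀ x, ∑ i, (pd i (fun y => Real.log (w y)) x) ^ 2 ≤ K ^ 2)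
    (φ : Fin 3 → (Fin 3 → ℝ) → ℝ)
    (hφ : ∀ i, ContDiff ℝ 2 (φ i))
    (hφper : ∀ i, ∀ A : Fin 3, A ≠ 0 → ∀ x, φ i (x + Pi.single A 1) = φ i x)
    (hφsupp : ∃ R : ℝ, ∀ i x, R ≤ |x 0| → φ i x = 0)
    (D : Set (Fin 3 → ℝ))
    (hD : D = {x | x 1 ∈ Set.Ico (0 : ℝ) 1 ∧ x 2 ∈ Set.Ico (0 : ℝ) 1}) :
    (∫ x in D, w x * ∑ i, ∑ j, (pd i (φ j) x) ^ 2)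
      ≤ 4 * (∫ x in D, w x *
              ((pd 1 (φ 2) x - pd 2 (φ 1) x) ^ 2
                + (pd 2 (φ 0) x - pd 0 (φ 2) x) ^ 2
                + (pd 0 (φ 1) x - pd 1 (φ 0) x) ^ 2))
        + 4 * (∫ x in D, w x * (∑ i, pd i (φ i) x) ^ 2)
        + 3 * K ^ 2 * (∫ x in D, w x * ∑ i, (φ i x) ^ 2) := by
  obtain rfl : pd = EllAux.P := by
    funext i g x
    exact hpd i g x
  obtain ⟨R, hR⟩ := hφsupp
  have hw1 : ContDiff ℝ 1 w := hw.of_le (by exact_mod_cast le_top)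
  have hsub : ∀ x : Fin 3 → ℝ, |R| + 1 ≤ |x 0| → R < |x 0| := fun x hx => by
    have := le_abs_self R
    linarith
  have hz : ∀ j x, |R| + 1 ≤ |x 0| → φ j x = 0 := fun j x hx => hR j x (hsub x hx).le
  have hpz : ∀ i j x, |R| + 1 ≤ |x 0| → EllAux.P i (φ j) x = 0 := fun i j x hx =>
    EllAux.P_supp (hR j) i x (hsub x hx)
  have hcφ : ∀ i, Continuous (φ i) := fun i => (hφ i).continuous
  have hcw : Continuous w := hw1.continuous
  have hp : ∀ i j, ContDiff ℝ 1 (EllAux.P i (φ j)) := fun i j =>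
    EllAux.P_contDiff (hφ j) (by norm_num) i
  have hcp : ∀ i j, Continuous (EllAux.P i (φ j)) := fun i j => (hp i j).continuous
  have h1 : ∀ i, ContDiff ℝ 1 (φ i) := fun i => (hφ i).of_le (by norm_num)
  let F : Fin 3 → (Fin 3 → ℝ) → ℝ := fun i y =>
    w y * (∑ j, φ j y * EllAux.P j (φ i) y - φ i y * ∑ j, EllAux.P j (φ j) y)
  have hF : ∀ i, ContDiff ℝ 1 (F i) := fun i =>
    hw1.mul ((ContDiff.sum fun j _ => (h1 j).mul (hp j i)).sub
      ((h1 i).mul (ContDiff.sum fun j _ => hp j j)))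
  have hint := EllAux.int_div (R := |R| + 1) (by positivity) F hF
    (fun i A hA x => by
      have hq : ∀ i j, EllAux.P i (φ j) (x + Pi.single A 1) = EllAux.P i (φ j) x := fun i j =>
        EllAux.P_per (hφper j A hA) i x
      simp only [F, hq, hwper A hA, hφper _ A hA])
    (fun i x hx => by simp [F, hz _ x hx])
  subst hD
  rw [EllAux.int_box (R := |R| + 1) _ (fun x hx => by simp [hpz _ _ x hx]),
    EllAux.int_box (R := |R| + 1) _ (fun x hx => by simp [hpz _ _ x hx]),
    EllAux.int_box (R := |R| + 1) _ (fun x hx => by simp [hpz _ _ x hx]),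
    EllAux.int_box (R := |R| + 1) _ (fun x hx => by simp [hz _ x hx])]
  have hI : ∀ g : (Fin 3 → ℝ) → ℝ, Continuous g →
      IntegrableOn g (Set.Icc (EllAux.lo (|R| + 1)) (EllAux.hi (|R| + 1))) := fun g hg =>
    hg.continuousOn.integrableOn_compact isCompact_Icc
  have c0 : Continuous fun x => w x * ∑ i, ∑ j, (EllAux.P i (φ j) x) ^ 2 := by fun_prop
  have c1 : Continuous fun x => w x *
      ((EllAux.P 1 (φ 2) x - EllAux.P 2 (φ 1) x) ^ 2
        + (EllAux.P 2 (φ 0) x - EllAux.P 0 (φ 2) x) ^ 2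
        + (EllAux.P 0 (φ 1) x - EllAux.P 1 (φ 0) x) ^ 2) := by fun_prop
  have c2 : Continuous fun x => w x * (∑ i, EllAux.P i (φ i) x) ^ 2 := by fun_prop
  have c3 : Continuous fun x => w x * ∑ i, (φ i x) ^ 2 := by fun_prop
  have c4 : Continuous fun x => ∑ i, EllAux.P i (F i) x :=
    continuous_finsetSum _ fun i _ => (EllAux.P_contDiff (m := 0) (hF i) (by simp) i).continuous
  have i1 := (hI _ c1).const_mul 4
  have i2 := (hI _ c2).const_mul 4
  have i3 := (hI _ c3).const_mul (3 * K ^ 2)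
  have i4 := (hI _ c4).const_mul 2
  have hmono := integral_mono (hI _ c0) (((i1.add i2).add i3).add i4) (fun x => by
    have ha := EllAux.alg (w x) K (hwpos x) (fun i => EllAux.P i (fun y => Real.log (w y)) x)
      (fun i => φ i x) (fun i j => EllAux.P i (φ j) x) (hlogw x)
    have hd := EllAux.divF w hw1 φ hφ x
    simp only [EllAux.P_log hw1 hwpos] at hd
    simp only [Pi.add_apply]
    rw [← hd] at ha
    exact ha)
  refine hmono.trans (le_of_eq ?_)
  rw [integral_add' ((i1.add i2).add i3) i4, integral_add' (i1.add i2) i3, integral_add' i1 i2,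
    integral_const_mul, integral_const_mul, integral_const_mul, integral_const_mul, hint]
  ring
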